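/- Let A be a C*-algebra in which tripotents are norm-total, and let T : A → A be a bounded linear map. Then T is a triple derivation if and only if T is triple derivable at orthogonal pairs and for every tripotent e ∈ A one has e T(e)* e = − e e* T(e) e* e (i.e. P₂(e)(T(e)) is skew-symmetric in the Peirce 2-space A₂(e)). -/

import Mathlib

variable {A : Type*} [NonUnitalNormedRing A] [StarRing A] [CStarRing A]
  [NormedSpace ℂ A] [IsScalarTower ℂ A A] [SMulCommClass ℂ A A]
  [StarModule ℂ A] [CompleteSpace A]

/-- The triple product `{x,y,z} = (1/2)(x y* z + z y* x)` on a C*-algebra. -/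
noncomputable def tp (x y z : A) : A := (2⁻¹ : ℂ) • (x * star y * z + z * star y * x)

/-- Orthogonality: `a ⊥ b` iff `a b* = 0` and `b* a = 0`. -/
def Orthog (a b : A) : Prop := a * star b = 0 ∧ star b * a = 0

/-- A map is triple derivable at orthogonal pairs. -/
def TripleDerivableAtOrthPairs (T : A → A) : Prop :=
  ∀ a b c : A, Orthog a b →
    tp (T a) b c + tp a (T b) c + tp a b (T c) = 0

/-- A triple derivation. -/
def IsTripleDerivation (δ : A → A) : Prop :=
  ∀ a b c : A, δ (tp a b c) = tp (δ a) b c + tp a (δ b) c + tp a b (δ c)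

set_option linter.unusedSectionVars false

/-- The defect of the triple Leibniz rule of `T` at `(a, b, c)`. -/
noncomputable def tripleDefect (T : A →L[ℂ] A) (a b c : A) : A :=
  T (tp a b c) - (tp (T a) b c + tp a (T b) c + tp a b (T c))

theorem tp_comm (a b c : A) : tp a b c = tp c b a := by
  simp only [tp, add_comm]

theorem tp_add_left (a a' b c : A) : tp (a + a') b c = tp a b c + tp a' b c := by
  simp only [tp, add_mul, mul_add, ← smul_add]
  congr 1
  abel

theorem tp_add_mid (a b b' c : A) : tp a (b + b') c = tp a b c + tp a b' c := by
  simp only [tp, star_add, add_mul, mul_add, ← smul_add]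
  congr 1
  abel

theorem tp_smul_left (r : ℂ) (a b c : A) : tp (r • a) b c = r • tp a b c := by
  simp only [tp, smul_mul_assoc, mul_smul_comm, ← smul_add, smul_comm r (2⁻¹ : ℂ)]

theorem tp_smul_mid (r : ℂ) (a b c : A) : tp a (r • b) c = star r • tp a b c := by
  simp only [tp, star_smul, smul_mul_assoc, mul_smul_comm, ← smul_add,
    smul_comm (star r) (2⁻¹ : ℂ)]

theorem tripleDefect_comm (T : A →L[ℂ] A) (a b c : A) :
    tripleDefect T a b c = tripleDefect T c b a := by
  simp only [tripleDefect, tp_comm a, tp_comm (T a)]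
  abel

theorem tripleDefect_add_left (T : A →L[ℂ] A) (a a' b c : A) :
    tripleDefect T (a + a') b c = tripleDefect T a b c + tripleDefect T a' b c := by
  simp only [tripleDefect, tp_add_left, map_add]
  abel

theorem tripleDefect_add_mid (T : A →L[ℂ] A) (a b b' c : A) :
    tripleDefect T a (b + b') c = tripleDefect T a b c + tripleDefect T a b' c := by
  simp only [tripleDefect, tp_add_mid, map_add]
  abel

theorem tripleDefect_add_right (T : A →L[ℂ] A) (a b c c' : A) :
    tripleDefect T a b (c + c') = tripleDefect T a b c + tripleDefect T a b c' := by
  simp only [tripleDefect_comm T a, tripleDefect_add_left]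

theorem tripleDefect_smul_left (T : A →L[ℂ] A) (r : ℂ) (a b c : A) :
    tripleDefect T (r • a) b c = r • tripleDefect T a b c := by
  simp only [tripleDefect, tp_smul_left, map_smul, smul_sub, smul_add]

theorem tripleDefect_smul_mid (T : A →L[ℂ] A) (r : ℂ) (a b c : A) :
    tripleDefect T a (r • b) c = star r • tripleDefect T a b c := by
  simp only [tripleDefect, tp_smul_mid, map_smul, smul_sub, smul_add]

theorem tripleDefect_smul_right (T : A →L[ℂ] A) (r : ℂ) (a b c : A) :
    tripleDefect T a b (r • c) = r • tripleDefect T a b c := by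
  simp only [tripleDefect_comm T a, tripleDefect_smul_left]

/-- The triple Leibniz rule holds as soon as it holds on the diagonal. -/
theorem tripleDefect_eq_zero_of_diag (T : A →L[ℂ] A)
    (h : ∀ a, tripleDefect T a a a = 0) (a b c : A) : tripleDefect T a b c = 0 := by
  have outer : ∀ x y : A, tripleDefect T x y x = 0 := by
    intro x y
    have h₁ := h (x + y)
    have h₂ := h (x + (-1 : ℂ) • y)
    have h₃ := h (x + Complex.I • y)
    have h₄ := h (x + (-Complex.I) • y)
    simp only [tripleDefect_add_left, tripleDefect_add_mid, tripleDefect_add_right,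
      tripleDefect_smul_left, tripleDefect_smul_mid, tripleDefect_smul_right] at h₁ h₂ h₃ h₄
    simp only [h, tripleDefect_comm T y x x, tripleDefect_comm T y y x, star_neg, star_one,
      Complex.star_def, Complex.conj_I] at h₁ h₂ h₃ h₄
    have key : (4 : ℂ) • tripleDefect T x y x = 0 := by
      linear_combination (norm := skip) h₁ - h₂ + Complex.I • h₃ - Complex.I • h₄
      match_scalars <;> ring_nf <;> simp [Complex.I_sq]
    simpa using key
  have := outer (a + c) b
  rw [tripleDefect_add_left, tripleDefect_add_right, tripleDefect_add_right, outer, outer,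
    tripleDefect_comm T c b a, zero_add, add_zero] at this
  simpa [← two_smul ℂ] using this

theorem continuous_tripleDefect_diag (T : A →L[ℂ] A) :
    Continuous fun a => tripleDefect T a a a := by
  simp only [tripleDefect, tp]
  fun_prop

theorem tp_eq_zero_of_orthog {a b : A} (h : Orthog a b) (c : A) : tp a b c = 0 := by
  simp [tp, h.1, h.2, mul_assoc]

theorem TripleDerivableAtOrthPairs.tripleDefect_eq_zero {T : A →L[ℂ] A}
    (hT : TripleDerivableAtOrthPairs (T : A → A)) {a b : A} (h : Orthog a b) (c : A) :
    tripleDefect T a b c = 0 := by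
  rw [tripleDefect, hT a b c h, tp_eq_zero_of_orthog h, map_zero, sub_zero]

theorem eq_zero_of_mul_star_mul_self {b : A} (h : b * star b * b = 0) : b = 0 := by
  rw [← CStarRing.star_mul_self_eq_zero_iff, ← CStarRing.star_mul_self_eq_zero_iff]
  simp only [star_mul, star_star]
  rw [mul_assoc, ← mul_assoc b, h, mul_zero]

/-- If `T` is triple derivable at orthogonal pairs, then `T e` has vanishing Peirce-0 part
relative to a tripotent `e`. -/
theorem TripleDerivableAtOrthPairs.peirce_zero {T : A →L[ℂ] A}
    (hT : TripleDerivableAtOrthPairs (T : A → A)) {e : A} (he : e * star e * e = e) :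
    T e - e * star e * T e - T e * star e * e + e * star e * T e * star e * e = 0 := by
  set x := T e with hx
  set b := x - e * star e * x - x * star e * e + e * star e * x * star e * e with hb
  have hse : star e * (e * star e) = star e := by simpa using congrArg star he
  have hse' : ∀ y, star e * (e * (star e * y)) = star e * y := fun y => by
    rw [← mul_assoc e, ← mul_assoc, hse]
  have heb : star e * b = 0 := by
    simp only [hb, mul_add, mul_sub, mul_assoc, hse']; abel
  have hbe : b * star e = 0 := by
    simp only [hb, add_mul, sub_mul, mul_assoc, hse]; abel
  have hbe' : star b * e = 0 := by simpa using congrArg star heb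
  have heb' : e * star b = 0 := by simpa using congrArg star hbe
  have hbe₁ : ∀ y, star b * (e * y) = 0 := fun y => by rw [← mul_assoc, hbe', zero_mul]
  have horth := hT e b b ⟨heb', hbe'⟩
  rw [tp_eq_zero_of_orthog ⟨heb', hbe'⟩, add_zero, tp, tp, ← smul_add,
    smul_eq_zero_iff_right (by norm_num), ← hx] at horth
  have hxb : x = b + e * star e * x + x * star e * e - e * star e * x * star e * e := by
    rw [hb]; abel
  have hbxb : star b * (x * star b) = star b * (b * star b) := by
    conv_lhs => rw [hxb]
    simp only [add_mul, mul_add, sub_mul, mul_assoc, heb', hbe₁, mul_zero, add_zero,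
      sub_zero]
  have hbxb₁ : ∀ y, star b * (x * (star b * y)) = star b * (b * (star b * y)) := fun y => by
    simpa only [mul_assoc] using congrArg (· * y) hbxb
  have h := congrArg (fun y => star b * y * star b) horth
  simp only [mul_add, add_mul, mul_zero, zero_mul, mul_assoc, heb', hbe₁, hbxb, hbxb₁,
    add_zero, zero_add] at h
  rw [← two_smul ℂ, smul_eq_zero_iff_right two_ne_zero] at h
  have hp : star b * b = 0 := by
    apply eq_zero_of_mul_star_mul_self
    simpa only [star_mul, star_star, mul_assoc, zero_mul] using congrArg (· * b) h
  exact (CStarRing.star_mul_self_eq_zero_iff b).1 hp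

/-- The triple product of a tripotent with itself is itself. -/
theorem tp_self_of_tripotent {e : A} (he : e * star e * e = e) : tp e e e = e := by
  rw [tp, he, ← two_smul ℂ, smul_smul]
  norm_num

theorem tripleDefect_tripotent (T : A →L[ℂ] A) {e : A} (he : e * star e * e = e) :
    tripleDefect T e e e =
      T e - (T e * star e * e + e * star e * T e + e * star (T e) * e) := by
  rw [tripleDefect, tp_self_of_tripotent he]
  simp only [tp]
  module

/-- in a C*-algebra whose tripotents are norm-total, a bounded linear map
is a triple derivation iff it is triple derivable at orthogonal pairs and
`P₂(e)(T e)` is skew-symmetric in `A₂(e)` for every tripotent `e`. -/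
theorem stmt12 (T : A →L[ℂ] A)
    (htot : ∀ a : A, ∀ ε : ℝ, 0 < ε →
      ∃ (n : ℕ) (e : Fin n → A) (lam : Fin n → ℂ),
        (∀ i, e i * star (e i) * e i = e i) ∧
        (∀ i j, i ≠ j → Orthog (e i) (e j)) ∧
        ‖a - ∑ i, lam i • e i‖ < ε) :
    IsTripleDerivation (T : A → A) ↔
      (TripleDerivableAtOrthPairs (T : A → A) ∧
       ∀ e : A, e * star e * e = e →
         e * star (T e) * e = -(e * star e * T e * star e * e)) := by
  constructor
  · intro hT
    refine ⟨fun a b c h => ?_, fun e he => ?_⟩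
    · rw [← hT a b c, tp_eq_zero_of_orthog h, map_zero]
    · have h := tripleDefect_tripotent T he
      rw [tripleDefect, hT e e e, sub_self] at h
      have he' : e * (star e * e) = e := by rw [← mul_assoc, he]
      have hee : ∀ y, e * (star e * (e * y)) = e * y := fun y => by
        rw [← mul_assoc, ← mul_assoc, he]
      have hse : ∀ y, star e * (e * (star e * y)) = star e * y := fun y => by
        simpa only [star_mul, star_star, mul_assoc] using congrArg (star · * y) he
      have h' := congrArg (fun y => e * star e * y * (star e * e)) h
      simp only [mul_sub, sub_mul, mul_add, add_mul, mul_assoc, he', hee, hse, mul_zero,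
        zero_mul] at h'
      simp only [mul_assoc]
      rw [eq_neg_iff_add_eq_zero, ← neg_eq_zero, h']
      abel
  · rintro ⟨hT, hskew⟩
    have diag_tripotent : ∀ e : A, e * star e * e = e → tripleDefect T e e e = 0 := by
      intro e he
      have h₀ := hT.peirce_zero he
      rw [tripleDefect_tripotent T he, hskew e he, ← h₀]
      abel
    have diag : ∀ a, tripleDefect T a a a = 0 := by
      intro a
      have hclosed : IsClosed {a | tripleDefect T a a a = 0} :=
        isClosed_eq (continuous_tripleDefect_diag T) continuous_const
      refine hclosed.closure_subset (Metric.mem_closure_iff.2 fun ε hε => ?_)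
      obtain ⟨n, e, lam, he, horth, hlt⟩ := htot a ε hε
      refine ⟨_, ?_, by rwa [dist_eq_norm]⟩
      have base : ∀ i j k, tripleDefect T (e i) (e j) (e k) = 0 := by
        intro i j k
        by_cases hij : i = j
        · by_cases hkj : k = j
          · rw [hij, hkj]
            exact diag_tripotent _ (he j)
          · rw [tripleDefect_comm]
            exact hT.tripleDefect_eq_zero (horth k j hkj) _
        · exact hT.tripleDefect_eq_zero (horth i j hij) _
      have left : ∀ j k, tripleDefect T (∑ i, lam i • e i) (e j) (e k) = 0 := fun j k =>
        Finset.sum_induction _ (fun x => tripleDefect T x (e j) (e k) = 0)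
          (fun x y hx hy => by rw [tripleDefect_add_left, hx, hy, add_zero])
          (by simpa using tripleDefect_smul_left T 0 0 (e j) (e k))
          (fun i _ => by rw [tripleDefect_smul_left, base, smul_zero])
      have mid : ∀ k, tripleDefect T (∑ i, lam i • e i) (∑ i, lam i • e i) (e k) = 0 := fun k =>
        Finset.sum_induction _ (fun x => tripleDefect T (∑ i, lam i • e i) x (e k) = 0)
          (fun x y hx hy => by rw [tripleDefect_add_mid, hx, hy, add_zero])
          (by simpa using tripleDefect_smul_mid T 0 (∑ i, lam i • e i) 0 (e k))
          (fun i _ => by rw [tripleDefect_smul_mid, left, smul_zero])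
      exact Finset.sum_induction _
        (fun x => tripleDefect T (∑ i, lam i • e i) (∑ i, lam i • e i) x = 0)
        (fun x y hx hy => by rw [tripleDefect_add_right, hx, hy, add_zero])
        (by simpa using tripleDefect_smul_right T 0 (∑ i, lam i • e i) (∑ i, lam i • e i) 0)
        (fun i _ => by rw [tripleDefect_smul_right, mid, smul_zero])
    intro a b c
    exact sub_eq_zero.1 (tripleDefect_eq_zero_of_diag T diag a b c)
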